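/- arXiv:1902.01470 — 6 statements merged into one kernel-verified Lean document; each statement's English description precedes it below -/
import Mathlib

section
/- Let 0 ≤ s ≤ r ≤ m be integers and let B be an s-dimensional F₂-linear subspace of E := Fin m → ZMod 2. Then for every ZMod 2-linear equivalence φ : (E ⧸ B) ≃ₗ[ZMod 2] (Fin (m−s) → ZMod 2), the set { (c_{/B}) ∘ φ.symm : c ∈ RM(m, r) } of projected codewords is equal to the Reed–Muller code RM(m−s, r−s). -/
open scoped Classical

/-- The Reed–Muller code RM(m,r): evaluations of multivariate polynomials over `ZMod 2`
of total degree at most `r` at all points of `Fin m → ZMod 2`. -/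
def RM (m r : ℕ) : Set ((Fin m → ZMod 2) → ZMod 2) :=
  {c | ∃ p : MvPolynomial (Fin m) (ZMod 2),
    p.totalDegree ≤ r ∧ ∀ z, c z = MvPolynomial.eval z p}

/-- The projection of `c : E → ZMod 2` on the cosets of a subspace `B`:
on each coset `T` it is the sum (in `ZMod 2`) of the values of `c` over the coset. -/
noncomputable def proj {m : ℕ} (B : Submodule (ZMod 2) (Fin m → ZMod 2))
    (c : (Fin m → ZMod 2) → ZMod 2) (T : (Fin m → ZMod 2) ⧸ B) : ZMod 2 :=
  ∑ z ∈ Finset.univ.filter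
      (fun z => (Submodule.Quotient.mk z : (Fin m → ZMod 2) ⧸ B) = T), c z

theorem exists_eval_comp_linearMap {σ τ R : Type*} [Fintype σ] [DecidableEq σ] [CommSemiring R]
    (L : (σ → R) →ₗ[R] (τ → R)) (p : MvPolynomial τ R) :
    ∃ q : MvPolynomial σ R, q.totalDegree ≤ p.totalDegree ∧
      ∀ x, MvPolynomial.eval x q = MvPolynomial.eval (L x) p := by
  let l : τ → MvPolynomial σ R := fun i =>
    ∑ j, MvPolynomial.monomial (Finsupp.single j 1) (L (Pi.single j 1) i)
  have hl : ∀ i, (l i).totalDegree ≤ 1 := fun i =>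
    MvPolynomial.totalDegree_finsetSum_le fun j _ =>
      (MvPolynomial.totalDegree_monomial_le _ _).trans (by simp)
  refine ⟨MvPolynomial.bind₁ l p, ?_, fun x => ?_⟩
  · rw [MvPolynomial.bind₁, MvPolynomial.aeval_def, MvPolynomial.eval₂_eq]
    refine MvPolynomial.totalDegree_finsetSum_le fun d hd => ?_
    refine (MvPolynomial.totalDegree_mul _ _).trans ?_
    rw [MvPolynomial.algebraMap_eq, MvPolynomial.totalDegree_C, zero_add]
    refine (MvPolynomial.totalDegree_finsetProd _ _).trans ?_
    refine le_trans (Finset.sum_le_sum fun i _ => ?_) (MvPolynomial.le_totalDegree hd)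
    refine (MvPolynomial.totalDegree_pow _ _).trans ?_
    exact (Nat.mul_le_mul_left _ (hl i)).trans_eq (mul_one _)
  · have hx : (fun i => MvPolynomial.eval x (l i)) = L x := by
      funext i
      conv_rhs => rw [← Finset.univ_sum_single x, map_sum, Finset.sum_apply]
      rw [map_sum]
      refine Finset.sum_congr rfl fun j _ => ?_
      have hsingle : Pi.single j (x j) = x j • (Pi.single j 1 : σ → R) := by
        rw [← Pi.single_smul, smul_eq_mul, mul_one]
      rw [hsingle, map_smul]
      simp [MvPolynomial.eval_monomial, mul_comm]
    rw [← hx, MvPolynomial.eval, MvPolynomial.eval₂Hom_bind₁]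
    rfl

theorem sum_prod_pow_zmod_two {τ : Type*} [Fintype τ] [DecidableEq τ] (a : τ → ℕ) :
    ∑ y : τ → ZMod 2, ∏ j, y j ^ a j = if ∀ j, a j ≠ 0 then 1 else 0 := by
  have hsum : ∀ k : ℕ, ∑ t : ZMod 2, t ^ k = if k ≠ 0 then 1 else 0 := by
    intro k
    rw [show (Finset.univ : Finset (ZMod 2)) = {0, 1} from rfl, Finset.sum_pair zero_ne_one]
    rcases eq_or_ne k 0 with rfl | hk
    · simp; rfl
    · simp [hk]
  have := Finset.prod_univ_sum (fun _ : τ => (Finset.univ : Finset (ZMod 2))) fun j t => t ^ a j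
  rw [Fintype.piFinset_univ] at this
  rw [← this]
  simp_rw [hsum]
  rw [Finset.prod_ite_zero]
  simp

theorem exists_eval_eq_sum_eval {σ τ : Type*} [Fintype σ] [Fintype τ] [DecidableEq τ]
    (p : MvPolynomial (σ ⊕ τ) (ZMod 2)) :
    ∃ q : MvPolynomial σ (ZMod 2), q.totalDegree ≤ p.totalDegree - Fintype.card τ ∧
      ∀ x, MvPolynomial.eval x q = ∑ y, MvPolynomial.eval (Sum.elim x y) p := by
  refine ⟨∑ a ∈ p.support with ∀ j, a (Sum.inr j) ≠ 0,
    MvPolynomial.monomial (Finsupp.equivFunOnFinite.symm fun i => a (Sum.inl i))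
      (p.coeff a), ?_, fun x => ?_⟩
  · refine MvPolynomial.totalDegree_finsetSum_le fun a ha => ?_
    obtain ⟨ha, hpos⟩ := Finset.mem_filter.1 ha
    refine (MvPolynomial.totalDegree_monomial_le _ _).trans ?_
    have hdeg := MvPolynomial.le_totalDegree ha
    rw [Finsupp.sum_fintype _ _ fun _ => rfl, Fintype.sum_sum_type] at hdeg
    rw [Finsupp.sum_fintype _ _ fun _ => rfl]
    have hcard : Fintype.card τ ≤ ∑ j, a (Sum.inr j) := by
      simpa using Finset.card_nsmul_le_sum Finset.univ (fun j => a (Sum.inr j)) 1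
        fun j _ => Nat.one_le_iff_ne_zero.2 (hpos j)
    exact Nat.le_sub_of_add_le ((Nat.add_le_add_left hcard _).trans hdeg)
  · simp_rw [MvPolynomial.eval_eq' _ p, Fintype.prod_sum_type, Sum.elim_inl, Sum.elim_inr]
    rw [Finset.sum_comm, map_sum, Finset.sum_filter]
    refine Finset.sum_congr rfl fun a _ => ?_
    rw [← Finset.mul_sum, ← Finset.mul_sum, sum_prod_pow_zmod_two, MvPolynomial.eval_monomial,
      Finsupp.prod_fintype _ _ fun _ => pow_zero _]
    split_ifs <;> simp

theorem proj_mk_eq_sum {m : ℕ} {ι : Type*} [Fintype ι] [DecidableEq ι]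
    {B : Submodule (ZMod 2) (Fin m → ZMod 2)}
    (β : (ι → ZMod 2) ≃ₗ[ZMod 2] B) (c : (Fin m → ZMod 2) → ZMod 2) (z : Fin m → ZMod 2) :
    proj B c (Submodule.Quotient.mk z) = ∑ y, c (z + β y) := by
  symm
  refine Finset.sum_bij (fun y _ => z + β y) (fun y _ => ?_) (fun y _ y' _ h => ?_)
    (fun w hw => ?_) fun _ _ => rfl
  · simp
  · simpa using h
  · rw [Finset.mem_filter, Submodule.Quotient.eq] at hw
    exact ⟨β.symm ⟨w - z, hw.2⟩, Finset.mem_univ _, by simp⟩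

theorem quotient_code_eq_RM (m r s : ℕ) (hsr : s ≤ r) (hrm : r ≤ m)
    (B : Submodule (ZMod 2) (Fin m → ZMod 2))
    (hB : Module.finrank (ZMod 2) B = s)
    (φ : ((Fin m → ZMod 2) ⧸ B) ≃ₗ[ZMod 2] (Fin (m - s) → ZMod 2)) :
    {d : (Fin (m - s) → ZMod 2) → ZMod 2 | ∃ c ∈ RM m r, d = (proj B c) ∘ φ.symm}
      = RM (m - s) (r - s) := by
  let β : (Fin s → ZMod 2) ≃ₗ[ZMod 2] B := (Module.finBasisOfFinrankEq _ _ hB).equivFun.symm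
  obtain ⟨g, hg⟩ := B.mkQ.exists_rightInverse_of_surjective B.range_mkQ
  have hg' : ∀ T, Submodule.Quotient.mk (g T) = T := fun T => LinearMap.congr_fun hg T
  ext d
  constructor
  · rintro ⟨c, ⟨p, hp, hc⟩, rfl⟩
    obtain ⟨q, hq, hqe⟩ := exists_eval_comp_linearMap
      (g ∘ₗ φ.symm.toLinearMap ∘ₗ LinearMap.funLeft (ZMod 2) (ZMod 2) Sum.inl +
        B.subtype ∘ₗ β.toLinearMap ∘ₗ LinearMap.funLeft (ZMod 2) (ZMod 2) Sum.inr) p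
    obtain ⟨q', hq', hqe'⟩ := exists_eval_eq_sum_eval q
    rw [Fintype.card_fin] at hq'
    refine ⟨q', hq'.trans (Nat.sub_le_sub_right (hq.trans hp) s), fun x => ?_⟩
    rw [hqe', Function.comp_apply, ← hg' (φ.symm x), proj_mk_eq_sum β]
    refine Finset.sum_congr rfl fun y _ => ?_
    rw [hqe, hc]
    rfl
  · rintro ⟨p, hp, hd⟩
    obtain ⟨π, hπ⟩ := B.subtype.exists_leftInverse_of_injective B.ker_subtype
    obtain ⟨q₁, hq₁, hqe₁⟩ := exists_eval_comp_linearMap (φ.toLinearMap ∘ₗ B.mkQ) p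
    obtain ⟨q₂, hq₂, hqe₂⟩ := exists_eval_comp_linearMap (β.symm.toLinearMap ∘ₗ π)
      (∏ j, MvPolynomial.X j)
    have hX : (∏ j : Fin s, (MvPolynomial.X j : MvPolynomial _ (ZMod 2))).totalDegree ≤ s :=
      (MvPolynomial.totalDegree_finsetProd _ _).trans (by simp)
    refine ⟨fun z => MvPolynomial.eval z (q₁ * q₂), ⟨q₁ * q₂, ?_, fun _ => rfl⟩, ?_⟩
    · have := MvPolynomial.totalDegree_mul q₁ q₂
      omega
    · funext x
      rw [Function.comp_apply, ← hg' (φ.symm x), proj_mk_eq_sum β, hd]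
      have h₁ : ∀ y, φ (B.mkQ (g (φ.symm x) + β y)) = x := fun y => by simp [hg']
      have h₂ : ∀ y, β.symm (π (g (φ.symm x) + β y)) = β.symm (π (g (φ.symm x))) + y := fun y => by
        have hy : π (β y : Fin m → ZMod 2) = β y := LinearMap.congr_fun hπ (β y)
        rw [map_add, map_add, hy, β.symm_apply_apply]
      simp only [map_mul, hqe₁, hqe₂, LinearMap.comp_apply, LinearEquiv.coe_coe, h₁, h₂, map_prod,
        MvPolynomial.eval_X]
      have hsum := Equiv.sum_comp (Equiv.addLeft (β.symm (π (g (φ.symm x)))))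
        fun y : Fin s → ZMod 2 => ∏ j, y j
      simp only [Equiv.coe_addLeft] at hsum
      have hone := sum_prod_pow_zmod_two fun _ : Fin s => 1
      simp only [pow_one, ne_eq, one_ne_zero, not_false_eq_true, implies_true, if_true] at hone
      rw [← Finset.mul_sum, hsum, hone, mul_one]
end

section
/- Let 0 ≤ r ≤ m, let c ∈ RM(m, r), and let B be an r-dimensional F₂-linear subspace of E := Fin m → ZMod 2. Then the projection c_{/B} is a constant function on E ⧸ B: for any two cosets T and T' of B, ∑_{z ∈ T} c z = ∑_{z ∈ T'} c z in ZMod 2. -/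
open scoped Classical

/-- Substituting polynomials of total degree at most one does not increase the total degree. -/
theorem MvPolynomial.totalDegree_bind₁_le {σ τ R : Type*} [CommSemiring R]
    (f : σ → MvPolynomial τ R) (hf : ∀ i, (f i).totalDegree ≤ 1) (p : MvPolynomial σ R) :
    (MvPolynomial.bind₁ f p).totalDegree ≤ p.totalDegree := by
  rw [MvPolynomial.bind₁, MvPolynomial.aeval_def, MvPolynomial.eval₂_eq]
  refine MvPolynomial.totalDegree_finsetSum_le fun d hd => ?_
  refine (MvPolynomial.totalDegree_mul _ _).trans ?_
  rw [MvPolynomial.algebraMap_eq, MvPolynomial.totalDegree_C, zero_add]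
  refine (MvPolynomial.totalDegree_finsetProd _ _).trans ?_
  refine le_trans (Finset.sum_le_sum fun i _ => ?_) (MvPolynomial.le_totalDegree hd)
  exact (MvPolynomial.totalDegree_pow _ _).trans
    ((Nat.mul_le_mul_left _ (hf i)).trans_eq (mul_one _))

/-- A codeword of `RM(m,r)` sums to zero over any parametrized affine flat with more than `r`
parameters. -/
theorem sum_affine_eq_zero_of_mem_RM {m r n : ℕ} {c : (Fin m → ZMod 2) → ZMod 2}
    (hc : c ∈ RM m r) (hn : r < n) (a : Fin m → ZMod 2) (v : Fin n → Fin m → ZMod 2) :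
    ∑ x : Fin n → ZMod 2, c (a + ∑ j, x j • v j) = 0 := by
  obtain ⟨p, hp, hcp⟩ := hc
  let f : Fin m → MvPolynomial (Fin n) (ZMod 2) := fun i =>
    MvPolynomial.C (a i) + ∑ j, MvPolynomial.C (v j i) * MvPolynomial.X j
  have hf : ∀ i, (f i).totalDegree ≤ 1 := by
    intro i
    refine (MvPolynomial.totalDegree_add _ _).trans (max_le ?_ ?_)
    · simp
    · refine MvPolynomial.totalDegree_finsetSum_le fun j _ => ?_
      refine (MvPolynomial.totalDegree_mul _ _).trans ?_
      simp
  have hdeg : (MvPolynomial.bind₁ f p).totalDegree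
      < (Fintype.card (ZMod 2) - 1) * Fintype.card (Fin n) := by
    have := MvPolynomial.totalDegree_bind₁_le f hf p
    simp only [ZMod.card, Fintype.card_fin]
    omega
  rw [← MvPolynomial.sum_eval_eq_zero _ hdeg]
  refine Finset.sum_congr rfl fun x _ => ?_
  rw [hcp]
  refine Eq.trans ?_ (MvPolynomial.eval₂Hom_bind₁ (RingHom.id (ZMod 2)) x f p).symm
  change MvPolynomial.eval _ p = MvPolynomial.eval (fun i => MvPolynomial.eval x (f i)) p
  congr 2
  funext i
  simp [f, mul_comm]

/-- A coset sum, parametrized by coordinates in a basis of the subspace. -/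
theorem proj_mk_eq_sum_s1 {m r : ℕ} (B : Submodule (ZMod 2) (Fin m → ZMod 2))
    (b : Module.Basis (Fin r) (ZMod 2) B) (c : (Fin m → ZMod 2) → ZMod 2)
    (a : Fin m → ZMod 2) :
    proj B c (Submodule.Quotient.mk a)
      = ∑ x : Fin r → ZMod 2, c (a + ∑ j, x j • (b j : Fin m → ZMod 2)) := by
  have hb : ∀ x : Fin r → ZMod 2,
      ∑ j, x j • (b j : Fin m → ZMod 2) = (b.equivFun.symm x : Fin m → ZMod 2) := by
    intro x
    simp [Module.Basis.equivFun_symm_apply]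
  simp only [hb]
  symm
  refine Finset.sum_bij (fun x _ => a + (b.equivFun.symm x : Fin m → ZMod 2)) ?_ ?_ ?_ ?_
  · intro x _
    rw [Finset.mem_filter, Submodule.Quotient.eq]
    exact ⟨Finset.mem_univ _, by simp only [add_sub_cancel_left, SetLike.coe_mem]⟩
  · intro x _ y _ h
    exact b.equivFun.symm.injective (Subtype.ext (add_left_cancel h))
  · intro z hz
    rw [Finset.mem_filter, Submodule.Quotient.eq] at hz
    exact ⟨b.equivFun ⟨z - a, hz.2⟩, Finset.mem_univ _, by
      rw [LinearEquiv.symm_apply_apply, add_sub_cancel]⟩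
  · intro _ _
    rfl

theorem proj_constant_of_finrank_eq_order (m r : ℕ) (hrm : r ≤ m)
    (c : (Fin m → ZMod 2) → ZMod 2) (hc : c ∈ RM m r)
    (B : Submodule (ZMod 2) (Fin m → ZMod 2))
    (hB : Module.finrank (ZMod 2) B = r)
    (T T' : (Fin m → ZMod 2) ⧸ B) :
    proj B c T = proj B c T' := by
  obtain ⟨a, rfl⟩ := Submodule.Quotient.mk_surjective B T
  obtain ⟨a', rfl⟩ := Submodule.Quotient.mk_surjective B T'
  let b := Module.finBasisOfFinrankEq (ZMod 2) B hB
  have h := sum_affine_eq_zero_of_mem_RM hc (Nat.lt_succ_self r) a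
    (Fin.cons (a' - a) fun j => (b j : Fin m → ZMod 2))
  rw [← (Fin.consEquiv fun _ : Fin (r + 1) => ZMod 2).sum_comp, Fintype.sum_prod_type] at h
  have h2 : ∀ g : ZMod 2 → ZMod 2, ∑ t, g t = g 0 + g 1 := fun g => Fin.sum_univ_two g
  rw [h2] at h
  simp only [Fin.consEquiv_apply, Fin.sum_univ_succ, Fin.cons_zero, Fin.cons_succ, zero_smul,
    one_smul, zero_add, ← add_assoc, add_sub_cancel] at h
  rw [proj_mk_eq_sum_s1 B b, proj_mk_eq_sum_s1 B b]
  exact CharTwo.add_eq_zero.mp h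
end

section
/- Let 0 ≤ r ≤ m with r ≥ 1, let c ∈ RM(m, r), and let B be a one-dimensional F₂-linear subspace of E := Fin m → ZMod 2. Then for every ZMod 2-linear equivalence φ : (E ⧸ B) ≃ₗ[ZMod 2] (Fin (m−1) → ZMod 2), the function (c_{/B}) ∘ φ.symm belongs to the Reed–Muller code RM(m−1, r−1). -/
open scoped Classical

open MvPolynomial in
/-- Changing degree-one factors by constants changes their product by lower-degree terms. -/
theorem MvPolynomial.totalDegree_prod_map_sub_prod_map_le {σ τ R : Type*} [CommRing R]
    (u v : σ → MvPolynomial τ R) (hu : ∀ i, (u i).totalDegree ≤ 1)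
    (hv : ∀ i, (v i).totalDegree ≤ 1) (huv : ∀ i, (u i - v i).totalDegree = 0)
    (t : Multiset σ) :
    ((t.map u).prod - (t.map v).prod).totalDegree ≤ t.card - 1 := by
  have hprod (t : Multiset σ) : (t.map v).prod.totalDegree ≤ t.card := by
    induction t using Multiset.induction with
    | empty => simp
    | cons a t ih =>
      have h := totalDegree_mul (v a) (t.map v).prod
      have := hv a
      simp only [Multiset.map_cons, Multiset.prod_cons, Multiset.card_cons]
      lia
  induction t using Multiset.induction with
  | empty => simp
  | cons a t ih =>
    rcases t.empty_or_exists_mem with rfl | ⟨b, hb⟩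
    · simp [huv]
    · have hpos : 0 < t.card := Multiset.card_pos_iff_exists_mem.2 ⟨b, hb⟩
      have key : ((a ::ₘ t).map u).prod - ((a ::ₘ t).map v).prod =
          u a * ((t.map u).prod - (t.map v).prod) + (u a - v a) * (t.map v).prod := by
        simp only [Multiset.map_cons, Multiset.prod_cons]
        ring
      rw [key, Multiset.card_cons, Nat.add_sub_cancel]
      refine (totalDegree_add _ _).trans (max_le ?_ ?_)
      · have := totalDegree_mul (u a) ((t.map u).prod - (t.map v).prod)
        have := hu a
        lia
      · have := totalDegree_mul (u a - v a) (t.map v).prod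
        have := huv a
        have := hprod t
        lia

open MvPolynomial in
/-- Two affine substitutions with the same linear part agree up to lower-degree terms. -/
theorem MvPolynomial.totalDegree_aeval_sub_aeval_le {σ τ R : Type*} [CommRing R]
    (u v : σ → MvPolynomial τ R) (hu : ∀ i, (u i).totalDegree ≤ 1)
    (hv : ∀ i, (v i).totalDegree ≤ 1) (huv : ∀ i, (u i - v i).totalDegree = 0)
    (p : MvPolynomial σ R) :
    (aeval u p - aeval v p).totalDegree ≤ p.totalDegree - 1 := by
  have haeval (w : σ → MvPolynomial τ R) : aeval w p =
      ∑ s ∈ p.support, C (p.coeff s) * ((Finsupp.toMultiset s).map w).prod := by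
    conv_lhs => rw [p.as_sum]
    simp only [map_sum, aeval_monomial, algebraMap_eq, Finsupp.toMultiset_map,
      Finsupp.prod_toMultiset]
    refine Finset.sum_congr rfl fun s _ => ?_
    rw [Finsupp.prod_mapDomain_index (by simp) (by simp [pow_add])]
  rw [haeval, haeval, ← Finset.sum_sub_distrib]
  refine totalDegree_finsetSum_le fun s hs => ?_
  rw [← mul_sub]
  have h₁ := totalDegree_mul (C (p.coeff s))
    (((Finsupp.toMultiset s).map u).prod - ((Finsupp.toMultiset s).map v).prod)
  have h₂ := totalDegree_prod_map_sub_prod_map_le u v hu hv huv (Finsupp.toMultiset s)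
  have h₃ : (Finsupp.toMultiset s).card ≤ p.totalDegree := by
    rw [Finsupp.card_toMultiset]
    exact le_totalDegree hs
  rw [totalDegree_C] at h₁
  lia

/-- On a line `B` spanned by `b`, the projection sums `c` over the pairs `{z, z + b}`. -/
theorem exists_proj_mk_eq_add {m : ℕ} (B : Submodule (ZMod 2) (Fin m → ZMod 2))
    (hB : Module.finrank (ZMod 2) B = 1) :
    ∃ b : Fin m → ZMod 2, ∀ (c : (Fin m → ZMod 2) → ZMod 2) (z : Fin m → ZMod 2),
      proj B c (Submodule.Quotient.mk z) = c (z + b) + c z := by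
  obtain ⟨⟨b, hbB⟩, hb0, hb⟩ := finrank_eq_one_iff'.1 hB
  refine ⟨b, fun c z => ?_⟩
  have hb0' : b ≠ 0 := fun h => hb0 (Subtype.ext h)
  have hcoset : Finset.univ.filter
      (fun y => (Submodule.Quotient.mk y : (Fin m → ZMod 2) ⧸ B) = Submodule.Quotient.mk z) =
      {z + b, z} := by
    ext y
    simp only [Finset.mem_filter, Finset.mem_univ, true_and, Finset.mem_insert,
      Finset.mem_singleton, Submodule.Quotient.eq]
    constructor
    · intro hy
      obtain ⟨a, ha⟩ := hb ⟨y - z, hy⟩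
      have ha' : a • b = y - z := congrArg Subtype.val ha
      have hcases : ∀ a : ZMod 2, a = 0 ∨ a = 1 := by decide
      rcases hcases a with rfl | rfl
      · right
        rw [zero_smul] at ha'
        exact sub_eq_zero.1 ha'.symm
      · left
        rw [one_smul] at ha'
        rw [ha', add_sub_cancel]
    · rintro (rfl | rfl)
      · simpa using hbB
      · simp
  rw [proj, hcoset, Finset.sum_pair (by simpa using hb0')]

open MvPolynomial in
theorem proj_one_dim_mem_RM (m r : ℕ) (hr : 1 ≤ r) (hrm : r ≤ m)
    (c : (Fin m → ZMod 2) → ZMod 2) (hc : c ∈ RM m r)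
    (B : Submodule (ZMod 2) (Fin m → ZMod 2))
    (hB : Module.finrank (ZMod 2) B = 1)
    (φ : ((Fin m → ZMod 2) ⧸ B) ≃ₗ[ZMod 2] (Fin (m - 1) → ZMod 2)) :
    (proj B c) ∘ φ.symm ∈ RM (m - 1) (r - 1) := by
  obtain ⟨p, hp, hcp⟩ := hc
  obtain ⟨b, hb⟩ := exists_proj_mk_eq_add B hB
  obtain ⟨g, hg⟩ := B.mkQ.exists_rightInverse_of_surjective B.range_mkQ
  set G : (Fin (m - 1) → ZMod 2) →ₗ[ZMod 2] (Fin m → ZMod 2) := g ∘ₗ φ.symm.toLinearMap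
  set q : Fin m → MvPolynomial (Fin (m - 1)) (ZMod 2) := (LinearMap.toMatrix' G).toMvPolynomial
  have hq (w) (i) : eval w (q i) = G w i := by
    rw [Matrix.toMvPolynomial_eval_eq_apply, LinearMap.toMatrix'_mulVec]
  have hqdeg (i) : (q i).totalDegree ≤ 1 := Matrix.toMvPolynomial_totalDegree_le _ i
  refine ⟨aeval (fun i => q i + C (b i)) p - aeval q p, ?_, fun w => ?_⟩
  · refine (totalDegree_aeval_sub_aeval_le _ q (fun i => ?_) hqdeg (fun i => by simp) p).trans
      (Nat.sub_le_sub_right hp 1)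
    exact (totalDegree_add _ _).trans (max_le (hqdeg i) (by simp))
  · have hmk : φ.symm w = Submodule.Quotient.mk (G w) :=
      (LinearMap.congr_fun hg (φ.symm w)).symm
    have heval (u : Fin m → MvPolynomial (Fin (m - 1)) (ZMod 2)) :
        eval w (aeval u p) = eval (fun i => eval w (u i)) p := by
      rw [← bind₁, eval, eval₂Hom_bind₁]
      rfl
    rw [Function.comp_apply, hmk, hb, hcp, hcp, map_sub, heval, heval, CharTwo.sub_eq_add]
    simp only [map_add, eval_C, hq]
    rfl
end

section
/- Let m ≥ 0, write E := Fin m → ZMod 2, and let L : E → ℝ. For b : ZMod 2 write sgn(b) := (if b = 0 then (1:ℝ) else −1), and for u : E define the Hadamard transform Ĺ(u) := ∑_{z : E} sgn(∑_i u i * z i) · L z. Suppose u* : E satisfies |Ĺ(u*)| ≥ |Ĺ(u)| for all u : E, let b* : ZMod 2 be 0 if Ĺ(u*) ≥ 0 and 1 otherwise, and define ĉ(z) := b* + ∑_i u*ᵢ * z i. Then ĉ ∈ RM(m, 1) and ∑_{z : E} sgn(ĉ z) · L z ≥ ∑_{z : E} sgn(c z) · L z for every c ∈ RM(m, 1). 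-/
open scoped Classical

/-- The sign of a bit: `+1` for `0` and `-1` for `1`. -/
def sgn (b : ZMod 2) : ℝ := if b = 0 then 1 else -1

/-- The Hadamard transform of `L` at `u`. -/
def hadamard {m : ℕ} (L : (Fin m → ZMod 2) → ℝ) (u : Fin m → ZMod 2) : ℝ :=
  ∑ z : Fin m → ZMod 2, sgn (∑ i : Fin m, u i * z i) * L z

theorem MvPolynomial.exists_eval_eq_affine {σ R : Type*} [Fintype σ] [CommSemiring R]
    {p : MvPolynomial σ R} (hp : p.totalDegree ≤ 1) :
    ∃ (b : R) (u : σ → R), ∀ z, MvPolynomial.eval z p = b + ∑ i, u i * z i := by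
  have monomial_affine : ∀ d : σ →₀ ℕ, ∃ (b : R) (u : σ → R), d ∈ p.support →
      ∀ z : σ → R, p.coeff d * ∏ i, z i ^ d i = b + ∑ i, u i * z i := by
    intro d
    by_cases hd : d ∈ p.support
    · have hdeg : d.degree ≤ 1 := (MvPolynomial.le_totalDegree hd).trans hp
      obtain h | h : d.degree = 0 ∨ d.degree = 1 := by omega
      · obtain rfl := (Finsupp.degree_eq_zero_iff d).mp h
        exact ⟨p.coeff 0, 0, fun _ z => by simp⟩
      · obtain ⟨i, rfl⟩ := (Finsupp.sum_eq_one_iff d).mp h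
        refine ⟨0, Pi.single i (p.coeff (Finsupp.single i 1)), fun _ z => ?_⟩
        simp [Finsupp.single_apply, Pi.single_apply, pow_ite, ite_mul]
    · exact ⟨0, 0, fun h => absurd h hd⟩
  choose b u hbu using monomial_affine
  refine ⟨∑ d ∈ p.support, b d, fun i => ∑ d ∈ p.support, u d i, fun z => ?_⟩
  rw [MvPolynomial.eval_eq', Finset.sum_congr rfl fun d hd => hbu d hd z,
    Finset.sum_add_distrib, Finset.sum_comm]
  simp only [Finset.sum_mul]

theorem affine_mem_RM {m : ℕ} (b : ZMod 2) (u : Fin m → ZMod 2) :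
    (fun z => b + ∑ i, u i * z i) ∈ RM m 1 := by
  refine ⟨MvPolynomial.C b + ∑ i, MvPolynomial.C (u i) * MvPolynomial.X i, ?_, by simp⟩
  refine (MvPolynomial.totalDegree_add _ _).trans (max_le (by simp) ?_)
  refine MvPolynomial.totalDegree_finsetSum_le fun i _ => ?_
  exact (MvPolynomial.totalDegree_mul _ _).trans (by simp)

theorem sgn_add (a b : ZMod 2) : sgn (a + b) = sgn a * sgn b := by
  have zero_or_one : ∀ x : ZMod 2, x = 0 ∨ x = 1 := by decide
  have one_add_one : (1 : ZMod 2) + 1 = 0 := by decide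
  obtain rfl | rfl := zero_or_one a <;> obtain rfl | rfl := zero_or_one b <;>
    simp [sgn, one_add_one]

theorem abs_sgn (b : ZMod 2) : |sgn b| = 1 := by
  unfold sgn
  split_ifs <;> simp

theorem sum_sgn_affine {m : ℕ} (L : (Fin m → ZMod 2) → ℝ) (b : ZMod 2) (u : Fin m → ZMod 2) :
    ∑ z, sgn (b + ∑ i, u i * z i) * L z = sgn b * hadamard L u := by
  simp only [hadamard, Finset.mul_sum, sgn_add, mul_assoc]

theorem FHT_decoder_maximizes_correlation (m : ℕ)
    (L : (Fin m → ZMod 2) → ℝ) (ustar : Fin m → ZMod 2)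
    (hstar : ∀ u : Fin m → ZMod 2, |hadamard L u| ≤ |hadamard L ustar|)
    (bstar : ZMod 2) (hb : bstar = if 0 ≤ hadamard L ustar then 0 else 1) :
    (fun z => bstar + ∑ i : Fin m, ustar i * z i) ∈ RM m 1 ∧
      ∀ c ∈ RM m 1, ∑ z : Fin m → ZMod 2, sgn (c z) * L z ≤
        ∑ z : Fin m → ZMod 2, sgn (bstar + ∑ i : Fin m, ustar i * z i) * L z := by
  refine ⟨affine_mem_RM bstar ustar, ?_⟩
  rintro c ⟨p, hp, hc⟩
  obtain ⟨b, u, hbu⟩ := MvPolynomial.exists_eval_eq_affine hp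
  have hopt : sgn bstar * hadamard L ustar = |hadamard L ustar| := by
    subst hb
    split_ifs with h
    · simp [sgn, abs_of_nonneg h]
    · simp [sgn, abs_of_neg (not_le.mp h)]
  simp only [hc, hbu, sum_sgn_affine, hopt]
  calc sgn b * hadamard L u ≤ |sgn b * hadamard L u| := le_abs_self _
    _ = |hadamard L u| := by rw [abs_mul, abs_sgn, one_mul]
    _ ≤ |hadamard L ustar| := hstar u
end

section
/- Let m ≥ 1, write E := Fin m → ZMod 2, let z₀ ∈ E be nonzero, and let B := ({0, z₀} : the one-dimensional subspace spanned by z₀). For L : E → ℝ define L_{/B} on each coset T of B by L_{/B}(T) := Real.log (Real.exp (∑_{z ∈ T} L z) + 1) − Real.log (∑_{z ∈ T} Real.exp (L z)). Let c₀ : E → ZMod 2, write sgn(b) := (if b = 0 then (1:ℝ) else −1) for b : ZMod 2, and define L' : E → ℝ by L' z := sgn(c₀ z) · L z. Then for every coset T of B: L'_{/B}(T) = sgn(∑_{z ∈ T} c₀ z) · L_{/B}(T), where the sum ∑_{z ∈ T} c₀ z is taken in ZMod 2. -/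
open scoped Classical

/-- The finset of points of a coset `T` of a subspace `B` of `Fin m → ZMod 2`. -/
noncomputable def coset {m : ℕ} (B : Submodule (ZMod 2) (Fin m → ZMod 2))
    (T : (Fin m → ZMod 2) ⧸ B) : Finset (Fin m → ZMod 2) :=
  Finset.univ.filter
    (fun z => (Submodule.Quotient.mk z : (Fin m → ZMod 2) ⧸ B) = T)

/-- The projected LLR of `L` on a coset `T` of a subspace `B`. -/
noncomputable def projLLR {m : ℕ} (B : Submodule (ZMod 2) (Fin m → ZMod 2))
    (L : (Fin m → ZMod 2) → ℝ) (T : (Fin m → ZMod 2) ⧸ B) : ℝ :=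
  Real.log (Real.exp (∑ z ∈ coset B T, L z) + 1) -
    Real.log (∑ z ∈ coset B T, Real.exp (L z))

/-- In a vector space over `ZMod 2`, a coset of the line spanned by `z₀` is a pair of points. -/
lemma coset_span_singleton_mk {m : ℕ} (z₀ a : Fin m → ZMod 2) :
    coset (Submodule.span (ZMod 2) {z₀}) (Submodule.Quotient.mk a) = {a, a + z₀} := by
  ext z
  simp only [coset, Finset.mem_filter, Finset.mem_univ, true_and, Finset.mem_insert,
    Finset.mem_singleton, Submodule.Quotient.eq, Submodule.mem_span_singleton]
  constructor
  · rintro ⟨c, hc⟩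
    have h_cases : ∀ d : ZMod 2, d = 0 ∨ d = 1 := by decide
    rcases h_cases c with rfl | rfl
    · left
      rw [zero_smul] at hc
      exact sub_eq_zero.mp hc.symm
    · right
      rw [one_smul] at hc
      rw [hc, add_sub_cancel]
  · rintro (rfl | rfl)
    · exact ⟨0, by simp⟩
    · exact ⟨1, by simp⟩

lemma log_exp_add_one_sub_log_neg_left (x y : ℝ) :
    Real.log (Real.exp (-x + y) + 1) - Real.log (Real.exp (-x) + Real.exp y) =
      -(Real.log (Real.exp (x + y) + 1) - Real.log (Real.exp x + Real.exp y)) := by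
  have h₁ : Real.exp (-x + y) + 1 = Real.exp (-x) * (Real.exp x + Real.exp y) := by
    rw [mul_add, ← Real.exp_add, ← Real.exp_add, neg_add_cancel, Real.exp_zero, add_comm]
  have h₂ : Real.exp (-x) + Real.exp y = Real.exp (-x) * (Real.exp (x + y) + 1) := by
    rw [mul_add, ← Real.exp_add, neg_add_cancel_left, mul_one, add_comm]
  rw [h₁, h₂, Real.log_mul (by positivity) (by positivity),
    Real.log_mul (by positivity) (by positivity)]
  ring

lemma log_exp_add_one_sub_log_neg_right (x y : ℝ) :
    Real.log (Real.exp (x + -y) + 1) - Real.log (Real.exp x + Real.exp (-y)) =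
      -(Real.log (Real.exp (x + y) + 1) - Real.log (Real.exp x + Real.exp y)) := by
  simpa only [add_comm] using log_exp_add_one_sub_log_neg_left y x

lemma log_exp_add_one_sub_log_sgn_mul (b c : ZMod 2) (x y : ℝ) :
    Real.log (Real.exp (sgn b * x + sgn c * y) + 1) -
        Real.log (Real.exp (sgn b * x) + Real.exp (sgn c * y)) =
      sgn (b + c) * (Real.log (Real.exp (x + y) + 1) - Real.log (Real.exp x + Real.exp y)) := by
  have h_zero : sgn 0 = 1 := if_pos rfl
  have h_one : sgn 1 = -1 := if_neg one_ne_zero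
  have h_two : (1 + 1 : ZMod 2) = 0 := rfl
  have h_cases : ∀ d : ZMod 2, d = 0 ∨ d = 1 := by decide
  rcases h_cases b with rfl | rfl <;> rcases h_cases c with rfl | rfl <;>
    simp only [h_zero, h_one, h_two, add_zero, zero_add, one_mul, neg_one_mul,
      log_exp_add_one_sub_log_neg_left, log_exp_add_one_sub_log_neg_right, neg_neg]

theorem projLLR_sign_equivariant (m : ℕ) (hm : 1 ≤ m)
    (z₀ : Fin m → ZMod 2) (hz₀ : z₀ ≠ 0)
    (L : (Fin m → ZMod 2) → ℝ) (c₀ : (Fin m → ZMod 2) → ZMod 2)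
    (T : (Fin m → ZMod 2) ⧸ Submodule.span (ZMod 2) {z₀}) :
    projLLR (Submodule.span (ZMod 2) {z₀}) (fun z => sgn (c₀ z) * L z) T =
      sgn (∑ z ∈ coset (Submodule.span (ZMod 2) {z₀}) T, c₀ z) *
        projLLR (Submodule.span (ZMod 2) {z₀}) L T := by
  obtain ⟨a, rfl⟩ := Submodule.Quotient.mk_surjective _ T
  have h_ne : a ≠ a + z₀ := fun h => hz₀ (left_eq_add.mp h)
  simp only [projLLR, coset_span_singleton_mk, Finset.sum_pair h_ne]
  exact log_exp_add_one_sub_log_sgn_mul _ _ _ _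
end

section
/- Let 𝒲 be a finite type, let W₀, W₁ : 𝒲 → ℝ be nonnegative, and let π : 𝒲 → 𝒲 satisfy π (π x) = x and W₁ x = W₀ (π x) for all x : 𝒲. Let n : ℕ and let C be a ZMod 2-submodule of (Fin n → ZMod 2). For b : ZMod 2 write W_b := (if b = 0 then W₀ else W₁), and for c ∈ C define the strict-ML success set S(c) := { y : Fin n → 𝒲 | ∀ c' ∈ C, c' ≠ c → ∏_i W_{c i}(y i) > ∏_i W_{c' i}(y i) }. Then for all c₁, c₂ ∈ C: ∑_{y ∈ S(c₁)} ∏_{i} W_{c₁ i}(y i) = ∑_{y ∈ S(c₂)} ∏_{i} W_{c₂ i}(y i); that is, the probability that the transmitted codeword is the unique maximum-likelihood candidate is the same for every codeword of the linear code C. -/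
open scoped Classical

/-- Applying `π` to the coordinates of `y` at which the binary word `d` is nonzero. -/
def flipAt {ι 𝒲 : Type*} (π : 𝒲 → 𝒲) (d : ι → ZMod 2) (y : ι → 𝒲) : ι → 𝒲 :=
  fun i => if d i = 0 then y i else π (y i)

theorem flipAt_involutive {ι 𝒲 : Type*} {π : 𝒲 → 𝒲} (hπ : Function.Involutive π)
    (d : ι → ZMod 2) : Function.Involutive (flipAt π d) := by
  intro y
  funext i
  by_cases h : d i = 0 <;> simp [flipAt, h, hπ (y i)]

/-- Flipping the output of a symmetric channel amounts to adding `d` to the input word. -/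
theorem prod_channel_flipAt {ι 𝒲 : Type*} [Fintype ι] {R : Type*} [CommMonoid R]
    {W₀ W₁ : 𝒲 → R} {π : 𝒲 → 𝒲} (hπ : Function.Involutive π) (hW : ∀ x, W₁ x = W₀ (π x))
    (c d : ι → ZMod 2) (y : ι → 𝒲) :
    ∏ i, (if c i = 0 then W₀ else W₁) (flipAt π d y i) =
      ∏ i, (if (c + d) i = 0 then W₀ else W₁) (y i) := by
  refine Finset.prod_congr rfl fun i _ => ?_
  have key : ∀ a : ZMod 2, a = 0 ∨ a = 1 := by decide
  have h11 : (1 + 1 : ZMod 2) = 0 := by decide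
  rcases key (c i) with hc | hc <;> rcases key (d i) with hd | hd <;>
    simp [flipAt, hc, hd, hW, hπ (y i), h11]

theorem ML_success_probability_codeword_independent
    (𝒲 : Type*) [Fintype 𝒲] (W₀ W₁ : 𝒲 → ℝ)
    (h₀ : ∀ x, 0 ≤ W₀ x) (h₁ : ∀ x, 0 ≤ W₁ x)
    (π : 𝒲 → 𝒲) (hπ : ∀ x, π (π x) = x) (hW : ∀ x, W₁ x = W₀ (π x))
    (n : ℕ) (C : Submodule (ZMod 2) (Fin n → ZMod 2))
    (c₁ c₂ : Fin n → ZMod 2) (hc₁ : c₁ ∈ C) (hc₂ : c₂ ∈ C) :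
    (∑ y : Fin n → 𝒲,
      if (∀ c' ∈ C, c' ≠ c₁ →
          (∏ i : Fin n, (if c₁ i = 0 then W₀ else W₁) (y i)) >
            (∏ i : Fin n, (if c' i = 0 then W₀ else W₁) (y i))) then
        ∏ i : Fin n, (if c₁ i = 0 then W₀ else W₁) (y i)
      else 0) =
    (∑ y : Fin n → 𝒲,
      if (∀ c' ∈ C, c' ≠ c₂ →
          (∏ i : Fin n, (if c₂ i = 0 then W₀ else W₁) (y i)) >
            (∏ i : Fin n, (if c' i = 0 then W₀ else W₁) (y i))) then
        ∏ i : Fin n, (if c₂ i = 0 then W₀ else W₁) (y i)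
      else 0) := by
  have hadd : ∀ c : Fin n → ZMod 2, c + (c₁ + c₂) + (c₁ + c₂) = c := fun c => by
    rw [add_assoc, ZModModule.add_self, add_zero]
  have h21 : c₂ + (c₁ + c₂) = c₁ := by
    rw [add_comm c₁, ← add_assoc, ZModModule.add_self, zero_add]
  have h12 : c₁ + (c₁ + c₂) = c₂ := by
    rw [← add_assoc, ZModModule.add_self, zero_add]
  have hd : c₁ + c₂ ∈ C := C.add_mem hc₁ hc₂
  refine Fintype.sum_equiv (flipAt_involutive hπ (c₁ + c₂)).toPerm _ _ fun y => ?_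
  simp only [Function.Involutive.coe_toPerm, prod_channel_flipAt hπ hW, h21]
  refine if_congr ⟨fun h c' hc' hne => ?_, fun h c' hc' hne => ?_⟩ rfl rfl
  · exact h _ (C.add_mem hc' hd) fun he => hne (by rw [← hadd c', he, h12])
  · have := h _ (C.add_mem hc' hd) fun he => hne (by rw [← hadd c', he, h21])
    rwa [hadd] at this
end
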